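/- If G is a strongly regular graph with parameters (1911, 270, 105, 27), then every clique in G has order at most 32. -/

import Mathlib

open Matrix in
/-- The sum of the entries of `A w`, for `A` the adjacency matrix of a regular graph. -/
theorem SimpleGraph.IsRegularOfDegree.one_dotProduct_adjMatrix_mulVec {V : Type*} [Fintype V]
    {G : SimpleGraph V} [DecidableRel G.Adj] {k : ℕ} (h : G.IsRegularOfDegree k) (w : V → ℤ) :
    1 ⬝ᵥ G.adjMatrix ℤ *ᵥ w = k * (1 ⬝ᵥ w) := by
  have h1 : (1 : V → ℤ) ᵥ* G.adjMatrix ℤ = (k : ℤ) • 1 := by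
    ext v
    simp [SimpleGraph.adjMatrix_vecMul_apply, h v]
  rw [dotProduct_mulVec, h1, smul_dotProduct, smul_eq_mul]

open Matrix in
/-- The squared norm of `A w`, for `A` the adjacency matrix of a strongly regular graph. -/
theorem SimpleGraph.IsSRGWith.adjMatrix_mulVec_dotProduct_self {V : Type*} [Fintype V]
    {G : SimpleGraph V} [DecidableRel G.Adj] {n k l m : ℕ} (h : G.IsSRGWith n k l m)
    (w : V → ℤ) :
    (G.adjMatrix ℤ *ᵥ w) ⬝ᵥ (G.adjMatrix ℤ *ᵥ w) =
      (k - m) * (w ⬝ᵥ w) + (l - m) * (w ⬝ᵥ G.adjMatrix ℤ *ᵥ w) + m * (1 ⬝ᵥ w) ^ 2 := by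
  classical
  have hcompl : Gᶜ.adjMatrix ℤ = Matrix.of (fun _ _ => 1) - 1 - G.adjMatrix ℤ := by
    ext i j
    by_cases hij : i = j
    · simp [hij]
    · by_cases ha : G.Adj i j <;> simp [hij, ha]
  have hone : Matrix.of (fun _ _ : V => (1 : ℤ)) *ᵥ w = (1 ⬝ᵥ w) • 1 := by
    ext i
    simp [mulVec, dotProduct]
  have hself : (G.adjMatrix ℤ *ᵥ w) ⬝ᵥ (G.adjMatrix ℤ *ᵥ w) =
      w ⬝ᵥ (G.adjMatrix ℤ ^ 2) *ᵥ w := by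
    rw [pow_two, ← mulVec_mulVec, dotProduct_mulVec w, ← mulVec_transpose,
      SimpleGraph.transpose_adjMatrix]
  rw [hself, h.matrix_eq, hcompl]
  simp only [add_mulVec, sub_mulVec, smul_mulVec, hone, one_mulVec, dotProduct_add,
    dotProduct_sub, dotProduct_smul, smul_eq_mul, dotProduct_comm w 1]
  simp only [nsmul_eq_mul]
  ring

open Matrix in
/-- The number of neighbours in `s` of a vertex, as an entry of a matrix-vector product. -/
theorem SimpleGraph.adjMatrix_mulVec_indicator_apply {V : Type*} [Fintype V] [DecidableEq V]
    (G : SimpleGraph V) [DecidableRel G.Adj] (s : Finset V) (v : V) :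
    (G.adjMatrix ℤ *ᵥ fun u => if u ∈ s then 1 else 0) v = (s.filter (G.Adj v)).card := by
  rw [SimpleGraph.adjMatrix_mulVec_apply, Finset.sum_boole]
  congr 2
  ext u
  simp [and_comm]

theorem SimpleGraph.IsClique.card_filter_adj {V : Type*} {G : SimpleGraph V} [DecidableRel G.Adj]
    {s : Finset V} (hs : G.IsClique (s : Set V)) {v : V} (hv : v ∈ s) :
    ((s.filter (G.Adj v)).card : ℤ) = s.card - 1 := by
  classical
  have h : s.filter (G.Adj v) = s.erase v := by
    ext u
    simp only [Finset.mem_filter, Finset.mem_erase]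
    exact ⟨fun ⟨h1, h2⟩ => ⟨h2.ne', h1⟩, fun ⟨h1, h2⟩ => ⟨h2, hs hv h2 h1.symm⟩⟩
  rw [h, Finset.cast_card_erase_of_mem hv]

open Matrix in
/-- The quadratic form `7 A + 21 I - J` is positive semidefinite: up to scaling it is the
projection onto the eigenspace of the eigenvalue `81`. -/
theorem srg_1911_form_nonneg {V : Type*} [Fintype V] {G : SimpleGraph V} [DecidableRel G.Adj]
    (h : G.IsSRGWith 1911 270 105 27) (w : V → ℤ) :
    0 ≤ 7 * (w ⬝ᵥ G.adjMatrix ℤ *ᵥ w) + 21 * (w ⬝ᵥ w) - (1 ⬝ᵥ w) ^ 2 := by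
  have hnorm := h.adjMatrix_mulVec_dotProduct_self w
  have hsum := h.regular.one_dotProduct_adjMatrix_mulVec w
  have hcard : (1 : V → ℤ) ⬝ᵥ 1 = 1911 := by simp [h.card]
  set x := G.adjMatrix ℤ *ᵥ w
  set t := (1 : V → ℤ) ⬝ᵥ w with ht
  have hsq : 0 ≤ ((7 : ℤ) • x + (21 : ℤ) • w - t • 1) ⬝ᵥ ((7 : ℤ) • x + (21 : ℤ) • w - t • 1) :=
    Finset.sum_nonneg fun i _ => mul_self_nonneg _
  simp only [add_dotProduct, sub_dotProduct, smul_dotProduct, dotProduct_add, dotProduct_sub,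
    dotProduct_smul, smul_eq_mul, dotProduct_comm w 1, dotProduct_comm x 1, dotProduct_comm x w,
    hcard, hnorm, hsum, ← ht] at hsq
  push_cast at hsq
  nlinarith

open Matrix in
/-- A vertex outside a clique has few or many neighbours in the clique. -/
theorem srg_1911_card_filter_adj_ineq {V : Type*} [Fintype V] {G : SimpleGraph V}
    [DecidableRel G.Adj] (h : G.IsSRGWith 1911 270 105 27) {s : Finset V}
    (hs : G.IsClique (s : Set V)) {x : V} (hx : x ∉ s) {b c : ℤ}
    (hb : ((s.filter (G.Adj x)).card : ℤ) = b) (hc : (s.card : ℤ) = c) :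
    (14 + 6 * c) * (35 * b + c) - 6 * (7 * b - c) ^ 2 ≤ 280 * (14 + 6 * c) := by
  classical
  let ind : Finset V → V → ℤ := fun t u => if u ∈ t then 1 else 0
  have hind (t : Finset V) (f : V → ℤ) : ind t ⬝ᵥ f = ∑ u ∈ t, f u := by
    simp [ind, dotProduct]
  have hone (t : Finset V) : 1 ⬝ᵥ ind t = t.card := by
    rw [dotProduct_comm, hind]; simp
  have hinter (t t' : Finset V) : ind t ⬝ᵥ ind t' = (t ∩ t').card := by
    rw [hind]; simp [ind]
  have hsymm (f g : V → ℤ) : f ⬝ᵥ G.adjMatrix ℤ *ᵥ g = g ⬝ᵥ G.adjMatrix ℤ *ᵥ f := by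
    rw [dotProduct_mulVec, ← mulVec_transpose, SimpleGraph.transpose_adjMatrix, dotProduct_comm]
  set d := s.filter (G.Adj x) with hd
  have hds : d ⊆ s := Finset.filter_subset _ _
  have hxd : x ∉ d := fun hxd => hx (hds hxd)
  have hdcl : G.IsClique (d : Set V) := hs.subset (by exact_mod_cast hds)
  have hdd : d.filter (G.Adj x) = d := by simp [hd]
  have hself {t : Finset V} (ht : G.IsClique (t : Set V)) {r : Finset V} (hr : r ⊆ t) :
      ind r ⬝ᵥ G.adjMatrix ℤ *ᵥ ind t = r.card * (t.card - 1) := by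
    rw [hind, Finset.sum_congr rfl fun u hu => (G.adjMatrix_mulVec_indicator_apply t u).trans
      (ht.card_filter_adj (hr hu)), Finset.sum_const, nsmul_eq_mul]
  have hxt (t : Finset V) : ind {x} ⬝ᵥ G.adjMatrix ℤ *ᵥ ind t = (t.filter (G.Adj x)).card := by
    rw [hind, Finset.sum_singleton]
    exact G.adjMatrix_mulVec_indicator_apply t x
  have hxx : ({x} : Finset V).filter (G.Adj x) = ∅ := by simp
  have hss := hself hs subset_rfl
  have hdds := hself hs hds
  have hddd := hself hdcl subset_rfl
  have hxs := hxt s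
  have hxd' := hxt d
  have hxx' := hxt {x}
  rw [hdd] at hxd'
  rw [hxx] at hxx'
  set m := 14 + 6 * c with hm
  have hmpos : 0 < m := by have : 0 ≤ c := hc ▸ Int.natCast_nonneg _; omega
  have key := srg_1911_form_nonneg h
    ((-m - 6 * (7 * b - c)) • ind s + (7 * m) • ind d + (-14 * m) • ind {x})
  simp only [add_dotProduct, smul_dotProduct, dotProduct_add, mulVec_add, mulVec_smul,
    dotProduct_smul, smul_eq_mul, hone, hinter, hsymm (ind s) (ind d), hsymm (ind s) (ind {x}),
    hsymm (ind d) (ind {x}), hss, hdds, hddd, hxs, hxd', hxx', Finset.inter_self,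
    Finset.inter_eq_right.2 hds, Finset.inter_eq_left.2 hds, Finset.inter_singleton_of_notMem hx,
    Finset.inter_singleton_of_notMem hxd, Finset.singleton_inter_of_notMem hx,
    Finset.singleton_inter_of_notMem hxd, Finset.card_singleton, Finset.card_empty, ← hd, hb,
    hc] at key
  have hfactor : 0 ≤ (14 * m) * (280 * m - (m * (35 * b + c) - 6 * (7 * b - c) ^ 2)) := by
    refine key.trans_eq ?_
    rw [hm]
    push_cast
    ring
  have := nonneg_of_mul_nonneg_right hfactor (by positivity)
  linarith

/-- A vertex that is not adjacent to every vertex of a clique of order between `33` and `91` has at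
most `7` neighbours in it. -/
theorem srg_1911_card_filter_adj_le_seven {V : Type*} [Fintype V] {G : SimpleGraph V}
    [DecidableRel G.Adj] (h : G.IsSRGWith 1911 270 105 27) {s : Finset V}
    (hs : G.IsClique (s : Set V)) (h33 : 33 ≤ s.card) (h91 : s.card ≤ 91) {x y : V}
    (hx : x ∉ s) (hy : y ∈ s) (hxy : ¬ G.Adj x y) : (s.filter (G.Adj x)).card ≤ 7 := by
  classical
  have h27 : (s.filter (G.Adj x)).card ≤ 27 := by
    have hne : x ≠ y := fun e => hx (e ▸ hy)
    rw [← h.of_not_adj hne hxy, ← Set.toFinset_card]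
    refine Finset.card_le_card fun u hu => ?_
    rw [Finset.mem_filter] at hu
    rw [Set.mem_toFinset, SimpleGraph.mem_commonNeighbors]
    exact ⟨hu.2, hs hy hu.1 fun e => hxy (e ▸ hu.2)⟩
  have key := srg_1911_card_filter_adj_ineq h hs hx rfl rfl
  by_contra! h8
  generalize (s.filter (G.Adj x)).card = b at *
  generalize s.card = c at *
  zify at h33 h91 h27 h8
  have hb8 : (8 : ℤ) ≤ b := h8
  nlinarith [mul_nonneg (sub_nonneg.2 hb8) (sub_nonneg.2 h27),
    mul_nonneg (sub_nonneg.2 h33) (sub_nonneg.2 h91)]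

open Matrix in
/-- The first two moments of the number of neighbours in a clique. -/
theorem srg_1911_clique_moments {V : Type*} [Fintype V] {G : SimpleGraph V}
    [DecidableEq V] [DecidableRel G.Adj] (h : G.IsSRGWith 1911 270 105 27) {s : Finset V}
    (hs : G.IsClique (s : Set V)) {c : ℤ} (hc : (s.card : ℤ) = c) :
    ∑ v ∈ sᶜ, ((s.filter (G.Adj v)).card : ℤ) = c * (271 - c) ∧
    ∑ v ∈ sᶜ, ((s.filter (G.Adj v)).card : ℤ) ^ 2 = c * (271 - c + (c - 1) * (107 - c)) := by
  let ind : V → ℤ := fun u => if u ∈ s then 1 else 0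
  have hA (v : V) : (G.adjMatrix ℤ *ᵥ ind) v = (s.filter (G.Adj v)).card :=
    G.adjMatrix_mulVec_indicator_apply s v
  have hin (v : V) (hv : v ∈ s) : ((s.filter (G.Adj v)).card : ℤ) = c - 1 := by
    rw [hs.card_filter_adj hv, hc]
  have h1 := h.regular.one_dotProduct_adjMatrix_mulVec ind
  have h2 := h.adjMatrix_mulVec_dotProduct_self ind
  have hone : 1 ⬝ᵥ ind = c := by simp [dotProduct, ind, hc]
  have hself : ind ⬝ᵥ ind = c := by simp [dotProduct, ind, hc]
  have hquad : ind ⬝ᵥ G.adjMatrix ℤ *ᵥ ind = c * (c - 1) := by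
    simp only [dotProduct, hA, ind, ite_mul, one_mul, zero_mul, Finset.sum_ite_mem,
      Finset.univ_inter]
    rw [Finset.sum_congr rfl hin, Finset.sum_const, nsmul_eq_mul, hc]
  rw [hone] at h1
  rw [hone, hself, hquad] at h2
  simp only [dotProduct, hA, Pi.one_apply, one_mul, ← pow_two] at h1 h2
  rw [← Finset.sum_add_sum_compl s, Finset.sum_congr rfl hin] at h1
  rw [← Finset.sum_add_sum_compl s,
    Finset.sum_congr rfl fun v hv => congrArg (· ^ 2) (hin v hv)] at h2
  simp only [Finset.sum_const, nsmul_eq_mul, hc] at h1 h2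
  push_cast at h1 h2
  constructor <;> linarith

/-- The Delsarte bound. -/
theorem srg_1911_clique_le_91 {V : Type*} [Fintype V] {G : SimpleGraph V}
    [DecidableRel G.Adj] (h : G.IsSRGWith 1911 270 105 27) {s : Finset V}
    (hs : G.IsClique (s : Set V)) : s.card ≤ 91 := by
  classical
  obtain ⟨h1, h2⟩ := srg_1911_clique_moments h hs rfl
  have hsq : 0 ≤ ∑ v ∈ sᶜ, (((s.filter (G.Adj v)).card : ℤ) - 9) ^ 2 :=
    Finset.sum_nonneg fun v _ => sq_nonneg _
  have hcompl : (sᶜ.card : ℤ) = 1911 - s.card := by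
    rw [Finset.card_compl, Nat.cast_sub (Finset.card_le_univ s), h.card]; rfl
  have hexp : ∑ v ∈ sᶜ, (((s.filter (G.Adj v)).card : ℤ) - 9) ^ 2 =
      ∑ v ∈ sᶜ, ((s.filter (G.Adj v)).card : ℤ) ^ 2 -
        18 * ∑ v ∈ sᶜ, ((s.filter (G.Adj v)).card : ℤ) + 81 * (sᶜ.card : ℤ) := by
    rw [Finset.mul_sum, ← Finset.sum_sub_distrib, mul_comm, ← nsmul_eq_mul, ← Finset.sum_const,
      ← Finset.sum_add_distrib]
    exact Finset.sum_congr rfl fun v _ => by ring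
  rw [hexp, h1, h2, hcompl] at hsq
  by_contra! h92
  have h92' : (92 : ℤ) ≤ s.card := by exact_mod_cast h92
  generalize (s.card : ℤ) = c at *
  nlinarith [mul_nonneg (sub_nonneg.2 h92') (sq_nonneg (c - 63)), sq_nonneg (c - 92)]

/-- If a strongly regular graph `G` with parameters `(1911, 270, 105, 27)` exists, then any
clique in `G` has order at most `32`. -/
theorem srg_1911_clique_le_32 {V : Type*} [Fintype V] (G : SimpleGraph V)
    [DecidableRel G.Adj] (h : G.IsSRGWith 1911 270 105 27)
    (s : Finset V) (hs : G.IsClique (s : Set V)) : s.card ≤ 32 := by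
  classical
  obtain ⟨t, ht⟩ := G.maximumClique_exists
  refine (ht.maximum s hs).trans ?_
  have htc := ht.isClique
  by_contra! h33
  have h91 := srg_1911_clique_le_91 h htc
  have h7 : ∀ v ∈ tᶜ, (t.filter (G.Adj v)).card ≤ 7 := by
    intro v hv
    rw [Finset.mem_compl] at hv
    obtain ⟨y, hy, hvy⟩ : ∃ y ∈ t, ¬ G.Adj v y := by
      by_contra! hall
      have hins : G.IsClique ((insert v t : Finset V) : Set V) := by
        rw [Finset.coe_insert]
        exact htc.insert fun y hy _ => hall y hy
      have := ht.maximum _ hins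
      rw [Finset.card_insert_of_notMem hv] at this
      omega
    exact srg_1911_card_filter_adj_le_seven h htc h33 h91 hv hy hvy
  obtain ⟨h1, h2⟩ := srg_1911_clique_moments h htc rfl
  have hle : ∑ v ∈ tᶜ, ((t.filter (G.Adj v)).card : ℤ) ^ 2 ≤
      7 * ∑ v ∈ tᶜ, ((t.filter (G.Adj v)).card : ℤ) := by
    rw [Finset.mul_sum]
    refine Finset.sum_le_sum fun v hv => ?_
    rw [pow_two]
    exact mul_le_mul_of_nonneg_right (by exact_mod_cast h7 v hv) (Int.natCast_nonneg _)
  rw [h1, h2] at hle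
  have h33' : (33 : ℤ) ≤ t.card := by exact_mod_cast h33
  have h91' : (t.card : ℤ) ≤ 91 := by exact_mod_cast h91
  generalize (t.card : ℤ) = c at *
  have hprod : c * (6 * (271 - c) - (c - 1) * (107 - c)) < 0 :=
    mul_neg_of_pos_of_neg (by omega)
      (by nlinarith [mul_nonneg (sub_nonneg.2 h33') (sub_nonneg.2 h91')])
  linarith
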